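/- arXiv:2311.08738 — 3 statements merged into one kernel-verified Lean document; each statement's English description precedes it below -/
import Mathlib

section
/- Let N ≥ 1 and let V ∈ ℂ^{N×N} be a Hermitian positive semi-definite matrix with V ≠ 0. Then rank(V) = 1 if and only if there exist a real number ϖ and Hermitian positive semi-definite matrices A, B ∈ ℂ^{N×N} such that: (i) tr(VA) − 2ϖ − tr(B) ≥ 0, (ii) tr(A) = 1, and (iii) B − V + ϖI is positive semi-definite. -/
open scoped ComplexOrder

open Matrix

/-- The square of a matrix of rank one is its trace times the matrix. -/
theorem Matrix.mul_self_eq_trace_smul_of_rank_eq_one {n K : Type*} [Fintype n] [Field K]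
    {V : Matrix n n K} (hV : V.rank = 1) : V * V = V.trace • V := by
  obtain ⟨w, u, rfl⟩ : ∃ w u : n → K, V = vecMulVec w u := by
    rw [rank_eq_finrank_span_cols] at hV
    obtain ⟨w, -, hw⟩ := finrank_eq_one_iff'.mp hV
    choose u hu using fun j => hw ⟨V.col j, Submodule.subset_span ⟨j, rfl⟩⟩
    refine ⟨w, u, ?_⟩
    ext i j
    have := congrFun (congrArg Subtype.val (hu j)) i
    simpa [vecMulVec_apply, mul_comm] using this.symm
  rw [vecMulVec_mul_vecMulVec, trace_vecMulVec, vecMulVec_smul, dotProduct_comm]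

/-- Real numbers `l i` dominated by `b i + c` with `b ≥ 0` satisfy `l i + l j ≤ 2 * c + ∑ k, b k`
for `i ≠ j`; if some convex combination of the `l k` reaches this upper bound, then all but a
largest one are nonpositive. -/
theorem nonpos_of_two_mul_add_sum_le {n : Type*} [Fintype n] {l a b : n → ℝ} {c : ℝ}
    (ha : ∀ i, 0 ≤ a i) (ha1 : ∑ i, a i = 1) (hb : ∀ i, 0 ≤ b i) (hlb : ∀ i, l i ≤ b i + c)
    (h : 2 * c + ∑ i, b i ≤ ∑ i, l i * a i) {i j : n} (hi : ∀ k, l k ≤ l i) (hij : j ≠ i) :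
    l j ≤ 0 := by
  classical
  have hle : ∑ k, l k * a k ≤ l i := by
    calc ∑ k, l k * a k ≤ ∑ k, l i * a k :=
          Finset.sum_le_sum fun k _ => mul_le_mul_of_nonneg_right (hi k) (ha k)
      _ = l i := by rw [← Finset.mul_sum, ha1, mul_one]
  have hpair : b j + b i ≤ ∑ k, b k := by
    rw [← Finset.sum_pair hij]
    exact Finset.sum_le_sum_of_subset_of_nonneg (Finset.subset_univ _) fun k _ _ => hb k
  linarith [hlb i, hlb j]

/-- Lemma 1 (rank-one lifting): for a nonzero Hermitian PSD matrix `V`,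
`rank V = 1` iff there exist `ϖ : ℝ` and Hermitian PSD matrices `A, B` with
`tr(VA) − 2ϖ − tr(B) ≥ 0`, `tr(A) = 1`, and `B − V + ϖ I ⪰ 0`. -/
theorem rank_one_iff_lifting (N : ℕ) (hN : 1 ≤ N)
    (V : Matrix (Fin N) (Fin N) ℂ) (hV : V.PosSemidef) (hV0 : V ≠ 0) :
    V.rank = 1 ↔
      ∃ (ϖ : ℝ) (A B : Matrix (Fin N) (Fin N) ℂ),
        A.PosSemidef ∧ B.PosSemidef ∧
        ((V * A).trace).re - 2 * ϖ - (B.trace).re ≥ 0 ∧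
        A.trace = 1 ∧
        (B - V + (ϖ : ℂ) • (1 : Matrix (Fin N) (Fin N) ℂ)).PosSemidef := by
  have htr : V.trace ≠ 0 := fun h => hV0 (hV.trace_eq_zero_iff.mp h)
  constructor
  · intro hr
    refine ⟨0, V.trace⁻¹ • V, V, hV.smul (inv_nonneg.mpr hV.trace_nonneg), hV, ?_, ?_, ?_⟩
    · simp [mul_self_eq_trace_smul_of_rank_eq_one hr, htr]
    · simp [htr]
    · simpa using PosSemidef.zero
  · rintro ⟨c, A, B, hA, hB, h, hA1, hBV⟩
    set l := hV.1.eigenvalues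
    set U : Matrix (Fin N) (Fin N) ℂ := hV.1.eigenvectorUnitary.1
    have hUU : Uᴴ * U = 1 := Unitary.coe_star_mul_self _
    have hUU' : U * Uᴴ = 1 := Unitary.coe_mul_star_self _
    have hD : Uᴴ * V * U = diagonal (RCLike.ofReal ∘ l) := by
      simpa [Unitary.conjStarAlgAut_apply] using! hV.1.conjStarAlgAut_star_eigenvectorUnitary
    have htrU (X : Matrix (Fin N) (Fin N) ℂ) : (Uᴴ * X * U).trace = X.trace := by
      rw [trace_mul_cycle, hUU', one_mul]
    have hdiag {X : Matrix (Fin N) (Fin N) ℂ} (hX : X.PosSemidef) (i : Fin N) :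
        0 ≤ ((Uᴴ * X * U) i i).re :=
      (Complex.le_def.mp (hX.conjTranspose_mul_mul_same U).diag_nonneg).1
    have hVA : ((V * A).trace).re = ∑ i, l i * ((Uᴴ * A * U) i i).re := by
      have : Uᴴ * (V * A) * U = diagonal (RCLike.ofReal ∘ l) * (Uᴴ * A * U) := by
        rw [← hD]
        simp only [Matrix.mul_assoc]
        rw [← Matrix.mul_assoc U, hUU', Matrix.one_mul]
      rw [← htrU, this]
      simp [trace, diagonal_mul]
    have hre (X : Matrix (Fin N) (Fin N) ℂ) :
        ∑ i, ((Uᴴ * X * U) i i).re = X.trace.re := by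
      rw [← htrU X]
      simp [trace]
    have hlb (i : Fin N) : l i ≤ ((Uᴴ * B * U) i i).re + c := by
      have := hdiag hBV i
      simp only [Matrix.mul_add, Matrix.mul_sub, Matrix.add_mul, Matrix.sub_mul, hD,
        Matrix.mul_smul, Matrix.smul_mul, Matrix.mul_one, hUU] at this
      simp at this
      linarith
    have : Nonempty (Fin N) := ⟨⟨0, hN⟩⟩
    obtain ⟨i, hi⟩ := Finite.exists_max l
    have hzero (j : Fin N) (hj : l j ≠ 0) : j = i := by
      by_contra hij
      refine hj (le_antisymm ?_ (hV.eigenvalues_nonneg j))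
      refine nonpos_of_two_mul_add_sum_le (hdiag hA) ?_ (hdiag hB) hlb ?_ hi hij
      · rw [hre, hA1, Complex.one_re]
      · rw [hre, ← hVA]
        linarith
    have hrank : V.rank ≤ 1 := by
      rw [hV.1.rank_eq_card_non_zero_eigs, Fintype.card_le_one_iff]
      rintro ⟨j, hj⟩ ⟨k, hk⟩
      exact Subtype.ext ((hzero j hj).trans (hzero k hk).symm)
    have hrank0 : V.rank ≠ 0 := fun h0 => by
      rw [hV.1.rank_eq_card_non_zero_eigs, Fintype.card_eq_zero_iff] at h0
      exact hV0 (hV.1.eigenvalues_eq_zero_iff.mp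
        (funext fun k => not_not.mp fun hk => h0.false ⟨k, hk⟩))
    omega
end

section
/- Let a > 0, b > e > 0, and μ > 0 be real numbers, and set c₁ = a/b and c₂ = a/e (so 0 < c₁ < c₂). Define P* = max(0, −(c₁ + c₂)/2 + (1/2)·√((c₂ − c₁)² + (4/μ)(c₂ − c₁))). Then P* is the unique maximizer over P ∈ [0, ∞) of the function f(P) = ln((a + bP)/(a + eP)) − μP. -/
/-- A point satisfying the first-order optimality conditions on `[0, ∞)` strictly maximizes the
per-subcarrier Lagrangian. -/
theorem log_ratio_sub_linear_lt_of_first_order {a b e μ S P : ℝ}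
    (ha : 0 < a) (he : 0 < e) (hbe : e < b) (hμ : 0 < μ) (hS : 0 ≤ S)
    (hle : a * (b - e) ≤ μ * ((a + e * S) * (a + b * S)))
    (heq : 0 < S → a * (b - e) = μ * ((a + e * S) * (a + b * S)))
    (hP : 0 ≤ P) (hne : P ≠ S) :
    Real.log ((a + b * P) / (a + e * P)) - μ * P <
      Real.log ((a + b * S) / (a + e * S)) - μ * S := by
  have hb : 0 < b := he.trans hbe
  have hbP : 0 < a + b * P := by positivity
  have heP : 0 < a + e * P := by positivity
  have hbS : 0 < a + b * S := by positivity
  have heS : 0 < a + e * S := by positivity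
  have hlog := Real.log_le_sub_one_of_pos
    (div_pos (div_pos hbP heP) (div_pos hbS heS))
  rw [Real.log_div (div_pos hbP heP).ne' (div_pos hbS heS).ne'] at hlog
  have hratio : (a + b * P) / (a + e * P) / ((a + b * S) / (a + e * S)) - 1 =
      a * (b - e) * (P - S) / ((a + e * P) * (a + b * S)) := by
    field_simp
    ring
  have hlt : a * (b - e) * (P - S) / ((a + e * P) * (a + b * S)) < μ * (P - S) := by
    rw [div_lt_iff₀ (by positivity)]
    have hstrict : 0 < μ * (a + b * S) * e * (P - S) ^ 2 := by
      have := sub_ne_zero.mpr hne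
      positivity
    have hslack : a * (b - e) * (P - S) ≤ μ * ((a + e * S) * (a + b * S)) * (P - S) := by
      rcases hS.eq_or_lt with h | h
      · exact mul_le_mul_of_nonneg_right hle (by linarith)
      · rw [heq h]
    linarith
  linarith

/-- Closed-form secure water-filling level: with `a > 0`, `b > e > 0`, `μ > 0`,
`c₁ = a/b`, `c₂ = a/e`, the point
`P* = max(0, −(c₁+c₂)/2 + (1/2)√((c₂−c₁)² + (4/μ)(c₂−c₁)))`
is the unique maximizer over `P ∈ [0, ∞)` of `ln((a+bP)/(a+eP)) − μP`. -/
theorem secure_waterfilling_unique_maximizer (a b e μ : ℝ)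
    (ha : 0 < a) (he : 0 < e) (hbe : e < b) (hμ : 0 < μ) :
    let c₁ := a / b
    let c₂ := a / e
    let Pstar := max 0
      (-(c₁ + c₂) / 2 + (1 / 2) * Real.sqrt ((c₂ - c₁) ^ 2 + (4 / μ) * (c₂ - c₁)))
    let f := fun P : ℝ => Real.log ((a + b * P) / (a + e * P)) - μ * P
    0 ≤ Pstar ∧ ∀ P : ℝ, 0 ≤ P → P ≠ Pstar → f P < f Pstar := by
  intro c₁ c₂ Pstar f
  have hb : 0 < b := he.trans hbe
  have hc₁ : 0 < c₁ := div_pos ha hb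
  have hc : c₁ < c₂ := div_lt_div_of_pos_left ha he hbe
  have hb₁ : b * c₁ = a := mul_div_cancel₀ a hb.ne'
  have he₂ : e * c₂ = a := mul_div_cancel₀ a he.ne'
  have hrad : 0 ≤ (c₂ - c₁) ^ 2 + (4 / μ) * (c₂ - c₁) := by
    have := sub_pos.mpr hc
    positivity
  have hsq := Real.sq_sqrt hrad
  have hnonneg := Real.sqrt_nonneg ((c₂ - c₁) ^ 2 + (4 / μ) * (c₂ - c₁))
  set s := Real.sqrt ((c₂ - c₁) ^ 2 + (4 / μ) * (c₂ - c₁))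
  obtain ⟨Q, hQ⟩ : ∃ Q, Q = -(c₁ + c₂) / 2 + (1 / 2) * s := ⟨_, rfl⟩
  have hstar : Pstar = max 0 Q := by rw [hQ]
  have hroot : μ * ((Q + c₁) * (Q + c₂)) = c₂ - c₁ := by
    have hs : s = 2 * Q + c₁ + c₂ := by linarith
    rw [hs] at hsq
    field_simp at hsq
    linarith
  have hstat : a * (b - e) = μ * ((a + e * Q) * (a + b * Q)) := by
    have hprod : (a + e * Q) * (a + b * Q) = b * e * ((Q + c₁) * (Q + c₂)) := by
      linear_combination (-(a + b * Q)) * he₂ - (e * Q + e * c₂) * hb₁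
    rw [hprod]
    linear_combination (-(b * e)) * hroot - b * he₂ + e * hb₁
  refine ⟨le_max_left _ _, fun P hP hne => ?_⟩
  refine log_ratio_sub_linear_lt_of_first_order ha he hbe hμ (le_max_left _ _) ?_ ?_ hP hne
  · rw [hstar]
    rcases le_total Q 0 with h | h
    · rw [max_eq_left h]
      have hQc : Q * (Q + c₁ + c₂) ≤ 0 :=
        mul_nonpos_of_nonpos_of_nonneg h (by linarith)
      have hbeμ : 0 < μ * (b * e) := by positivity
      have hdiff : (a + e * Q) * (a + b * Q) = a * a + b * e * (Q * (Q + c₁ + c₂)) := by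
        linear_combination (-(Q * e)) * hb₁ - Q * b * he₂
      rw [hstat, hdiff]
      nlinarith [mul_nonpos_of_nonneg_of_nonpos hbeμ.le hQc]
    · rw [max_eq_right h, hstat]
  · rw [hstar]
    intro h
    have hQpos : 0 < Q := by simpa using h
    rw [max_eq_right hQpos.le, hstat]
end

section
/- Let f > 0 and ζ, τ₀ ∈ ℝ with sin(2πfτ₀ − ζ) ≠ 0, and let γ(τ) = cos(2πfτ − ζ). Let b ∈ ℝ satisfy cos(2πfb − ζ) = −1 together with 0 < |τ₀ − b| < 1/(2f), where b < τ₀ if sin(2πfτ₀ − ζ) < 0 and b > τ₀ if sin(2πfτ₀ − ζ) > 0. Define a = −πf·sin(2πfτ₀ − ζ)/(τ₀ − b) and c = cos(2πfτ₀ − ζ) − a(τ₀ − b)², and set g(τ) = a(τ − b)² + c. Then a > 0, g(τ₀) = γ(τ₀), g'(τ₀) = γ'(τ₀) = −2πf·sin(2πfτ₀ − ζ), and g(τ) ≥ γ(τ) for all τ ∈ ℝ. -/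
theorem Real.mul_sin_le_mul_sin {u v : ℝ} (hu : 0 < u) (huv : u ≤ v) (hv : v ≤ Real.pi) :
    u * Real.sin v ≤ v * Real.sin u := by
  have hv0 : 0 < v := hu.trans_le huv
  have h := strictConcaveOn_sin_Icc.concaveOn.2
    (⟨le_rfl, Real.pi_pos.le⟩ : (0 : ℝ) ∈ Set.Icc 0 Real.pi)
    (⟨hv0.le, hv⟩ : v ∈ Set.Icc 0 Real.pi)
    (sub_nonneg.2 ((div_le_one hv0).2 huv)) (div_nonneg hu.le hv0.le) (sub_add_cancel 1 (u / v))
  simp only [smul_eq_mul, Real.sin_zero, mul_zero, zero_add, div_mul_cancel₀ u hv0.ne'] at h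
  rw [div_mul_eq_mul_div, div_le_iff₀ hv0] at h
  linarith

theorem Real.exists_cos_sub_cos_eq {u v : ℝ} (huv : u < v) :
    ∃ ξ ∈ Set.Ioo u v, (v ^ 2 - u ^ 2) * Real.sin ξ = (Real.cos u - Real.cos v) * (2 * ξ) := by
  obtain ⟨ξ, hξ, h⟩ := exists_ratio_hasDerivAt_eq_ratio_slope Real.cos (fun x => -Real.sin x) huv
    Real.continuous_cos.continuousOn (fun x _ => Real.hasDerivAt_cos x) (fun x => x ^ 2)
    (fun x => 2 * x) (by fun_prop) (fun x _ => by simpa using hasDerivAt_pow 2 x)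
  exact ⟨ξ, hξ, by linarith⟩

/-- On `[0, π]`, `cos` as a function of the square of its argument lies above its tangents. -/
theorem Real.cos_sub_cos_le_of_mem_Icc {y x : ℝ} (hy0 : 0 < y) (hy : y ≤ Real.pi) (hx0 : 0 ≤ x)
    (hx : x ≤ Real.pi) :
    Real.cos y - Real.cos x ≤ Real.sin y / y / 2 * (x ^ 2 - y ^ 2) := by
  rw [div_div, div_mul_eq_mul_div, le_div_iff₀ (by positivity)]
  rcases lt_trichotomy x y with hxy | rfl | hxy
  · obtain ⟨ξ, ⟨h1, h2⟩, h⟩ := Real.exists_cos_sub_cos_eq hxy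
    have hξ : 0 < ξ := by linarith
    have hs := mul_le_mul_of_nonneg_left (Real.mul_sin_le_mul_sin hξ h2.le hy)
      (show 0 ≤ y ^ 2 - x ^ 2 by nlinarith)
    refine le_of_mul_le_mul_left ?_ hξ
    linear_combination hs + y * h
  · simp
  · obtain ⟨ξ, ⟨h1, h2⟩, h⟩ := Real.exists_cos_sub_cos_eq hxy
    have hξ : 0 < ξ := by linarith
    have hs := mul_le_mul_of_nonneg_left (Real.mul_sin_le_mul_sin hy0 h1.le (by linarith))
      (show 0 ≤ x ^ 2 - y ^ 2 by nlinarith)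
    refine le_of_mul_le_mul_left ?_ hξ
    linear_combination hs - y * h

theorem Real.cos_sub_cos_le {y : ℝ} (hy0 : y ≠ 0) (hy : |y| ≤ Real.pi) (x : ℝ) :
    Real.cos y - Real.cos x ≤ Real.sin y / y / 2 * (x ^ 2 - y ^ 2) := by
  wlog hpos : 0 < y generalizing y
  · have hneg : 0 < -y := by
      rcases lt_or_gt_of_ne hy0 with h | h
      · linarith
      · exact absurd h hpos
    simpa using this (neg_ne_zero.2 hy0) (by rwa [abs_neg]) hneg
  rw [abs_of_pos hpos] at hy
  have hz := Real.cos_sub_cos_le_of_mem_Icc hpos hy (Real.arccos_nonneg (Real.cos x))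
    (Real.arccos_le_pi _)
  rw [Real.cos_arccos (Real.neg_one_le_cos x) (Real.cos_le_one x)] at hz
  have hle : Real.arccos (Real.cos x) ≤ |x| := by
    rcases le_total |x| Real.pi with h | h
    · rw [← Real.cos_abs, Real.arccos_cos (abs_nonneg x) h]
    · exact (Real.arccos_le_pi _).trans h
  have hsq : Real.arccos (Real.cos x) ^ 2 ≤ x ^ 2 :=
    sq_le_sq.2 (by rwa [abs_of_nonneg (Real.arccos_nonneg _)])
  have hs : 0 ≤ Real.sin y / y / 2 := by
    have := Real.sin_nonneg_of_nonneg_of_le_pi hpos.le hy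
    positivity
  exact hz.trans (mul_le_mul_of_nonneg_left (by linarith) hs)

/-- BSUM quadratic surrogate (Cases 1–2, eqs. (31), (33)): the parabola with vertex
above the valley point `b` of `γ(τ) = cos(2πfτ − ζ)` adjacent to `τ₀`, tangent to
`γ` at `τ₀`, has positive leading coefficient, matches `γ` and its derivative at
`τ₀`, and globally majorizes `γ`. -/
theorem bsum_surrogate_tangent (f ζ τ₀ b : ℝ) (hf : 0 < f)
    (hsin : Real.sin (2 * Real.pi * f * τ₀ - ζ) ≠ 0)
    (hb : Real.cos (2 * Real.pi * f * b - ζ) = -1)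
    (hd0 : 0 < |τ₀ - b|) (hd1 : |τ₀ - b| < 1 / (2 * f))
    (hleft : Real.sin (2 * Real.pi * f * τ₀ - ζ) < 0 → b < τ₀)
    (hright : 0 < Real.sin (2 * Real.pi * f * τ₀ - ζ) → τ₀ < b) :
    let a := -(Real.pi * f * Real.sin (2 * Real.pi * f * τ₀ - ζ)) / (τ₀ - b)
    let c := Real.cos (2 * Real.pi * f * τ₀ - ζ) - a * (τ₀ - b) ^ 2
    let g := fun τ : ℝ => a * (τ - b) ^ 2 + c
    let γ := fun τ : ℝ => Real.cos (2 * Real.pi * f * τ - ζ)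
    0 < a ∧ g τ₀ = γ τ₀ ∧ deriv g τ₀ = deriv γ τ₀ ∧
    deriv γ τ₀ = -(2 * Real.pi * f) * Real.sin (2 * Real.pi * f * τ₀ - ζ) ∧
    ∀ τ : ℝ, γ τ ≤ g τ := by
  intro a c g γ
  have hd : τ₀ - b ≠ 0 := abs_pos.1 hd0
  have hγ : HasDerivAt γ (-(2 * Real.pi * f) * Real.sin (2 * Real.pi * f * τ₀ - ζ)) τ₀ := by
    have h := (((hasDerivAt_id τ₀).const_mul (2 * Real.pi * f)).sub_const ζ).cos
    refine h.congr_deriv ?_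
    simp only [id]
    ring
  have hg : HasDerivAt g (-(2 * Real.pi * f) * Real.sin (2 * Real.pi * f * τ₀ - ζ)) τ₀ := by
    have h := ((((hasDerivAt_id τ₀).sub_const b).pow 2).const_mul a).add_const c
    refine h.congr_deriv ?_
    simp only [a, id]
    norm_num only [pow_one]
    field_simp
  refine ⟨?_, ?_, hg.deriv.trans hγ.deriv.symm, hγ.deriv, fun τ => ?_⟩
  · have hpf : 0 < Real.pi * f := mul_pos Real.pi_pos hf
    rcases lt_or_gt_of_ne hsin with h | h
    · exact div_pos (neg_pos.2 (mul_neg_of_pos_of_neg hpf h)) (sub_pos.2 (hleft h))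
    · exact div_pos_of_neg_of_neg (neg_neg_of_pos (mul_pos hpf h)) (sub_neg.2 (hright h))
  · simp only [g, c, γ]
    ring
  · have hsb : Real.sin (2 * Real.pi * f * b - ζ) = 0 := by
      have := Real.sin_sq_add_cos_sq (2 * Real.pi * f * b - ζ)
      rw [hb] at this
      exact pow_eq_zero_iff two_ne_zero |>.1 (by linarith)
    have hsplit (t : ℝ) : 2 * Real.pi * f * t - ζ
        = 2 * Real.pi * f * (t - b) + (2 * Real.pi * f * b - ζ) := by ring
    have hcos (t : ℝ) : Real.cos (2 * Real.pi * f * t - ζ)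
        = -Real.cos (2 * Real.pi * f * (t - b)) := by
      rw [hsplit, Real.cos_add, hb, hsb]
      ring
    have hsin' : Real.sin (2 * Real.pi * f * τ₀ - ζ)
        = -Real.sin (2 * Real.pi * f * (τ₀ - b)) := by
      rw [hsplit, Real.sin_add, hb, hsb]
      ring
    have hw : 0 < 2 * Real.pi * f := by positivity
    have hy : |2 * Real.pi * f * (τ₀ - b)| ≤ Real.pi := by
      rw [abs_mul, abs_of_pos hw]
      calc 2 * Real.pi * f * |τ₀ - b| ≤ 2 * Real.pi * f * (1 / (2 * f)) := by gcongr
        _ = Real.pi := by field_simp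
    have h := Real.cos_sub_cos_le (mul_ne_zero hw.ne' hd) hy (2 * Real.pi * f * (τ - b))
    have ha : Real.sin (2 * Real.pi * f * (τ₀ - b)) / (2 * Real.pi * f * (τ₀ - b)) / 2 *
        ((2 * Real.pi * f * (τ - b)) ^ 2 - (2 * Real.pi * f * (τ₀ - b)) ^ 2)
        = a * ((τ - b) ^ 2 - (τ₀ - b) ^ 2) := by
      simp only [a, hsin']
      field_simp
    simp only [g, c, γ, hcos]
    linarith
end
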